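/- Race detection theorem (barrier-free case), part 1: Let P be a multithreaded program without barriers, G its race-detecting state graph, s0 a state, u0 = ⟨s0, ∅^TID⟩, and assume the set of nodes reachable from u0 is finite. Then P has an execution from s0 with a data race if and only if G detects a race from u0. -/

import Mathlib

namespace MC

/-- Statements of a thread: acquire/release a lock, barrier exit, or an nsync statement. -/
inductive Stmt (Lock NStmt : Type) where
  | acquire : Lock → Stmt Lock NStmt
  | release : Lock → Stmt Lock NStmt
  | exit : Stmt Lock NStmt
  | nsync : NStmt → Stmt Lock NStmt

/-- The kind of a local state: acquire state (with its lock), release state,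
barrier state, nsync state, or terminal state. -/
inductive LKind (Lock : Type) where
  | acquire : Lock → LKind Lock
  | release : Lock → LKind Lock
  | barrier : LKind Lock
  | nsync : LKind Lock
  | term : LKind Lock

def LKind.isBarrier {L : Type} : LKind L → Bool
  | .barrier => true
  | _ => false

def LKind.isTerm {L : Type} : LKind L → Bool
  | .term => true
  | _ => false

/-- A multithreaded program with thread ID set `Fin n`. -/
structure Program where
  n : ℕ
  npos : 0 < n
  Lock : Type
  Shared : Type
  Local : Fin n → Type
  NStmt : Fin n → Type
  kind : ∀ i, Local i → LKind Lock
  next : ∀ i, Local i → Local i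
  stmts : ∀ i, Local i → Set (NStmt i)
  stmtsNonempty : ∀ i σ, kind i σ = .nsync → (stmts i σ).Nonempty
  update : ∀ i, Local i → NStmt i → Shared → Local i × Shared

variable {P : Program}

/-- Global statements: a thread ID together with one of its statements. -/
abbrev GStmt (P : Program) := Σ i : Fin P.n, Stmt P.Lock (P.NStmt i)

def GStmt.isNsync (t : GStmt P) : Prop := ∃ m, t.2 = Stmt.nsync m
def GStmt.isExit (t : GStmt P) : Prop := t.2 = Stmt.exit
def GStmt.isExitZero (t : GStmt P) : Prop := t.2 = Stmt.exit ∧ (t.1 : ℕ) = 0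
def GStmt.isReleaseOn (t : GStmt P) (l : P.Lock) : Prop := t.2 = Stmt.release l
def GStmt.isAcquireOn (t : GStmt P) (l : P.Lock) : Prop := t.2 = Stmt.acquire l

/-- A global state: local state of each thread, shared state, lock state
(`none` = free), and barrier wait set. -/
structure GState (P : Program) where
  loc : ∀ i, P.Local i
  sh : P.Shared
  lk : P.Lock → Option (Fin P.n)
  wait : Set (Fin P.n)

/-- Enabledness of a statement at a global state. -/
def Enabled (s : GState P) : GStmt P → Prop
  | ⟨i, st⟩ =>
    match P.kind i (s.loc i), st with
    | .acquire l, .acquire l' => l = l' ∧ s.lk l = none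
    | .release l, .release l' => l = l' ∧ s.lk l = some i
    | .barrier, .exit => i ∉ s.wait
    | .nsync, .nsync m => m ∈ P.stmts i (s.loc i)
    | _, _ => False

open Classical in
/-- Execution of a statement at a global state. -/
noncomputable def execute (s : GState P) : GStmt P → GState P
  | ⟨i, st⟩ =>
    let r : P.Local i × P.Shared × (P.Lock → Option (Fin P.n)) :=
      match st with
      | .acquire l => (P.next i (s.loc i), s.sh, fun l' => if l' = l then some i else s.lk l')
      | .release l => (P.next i (s.loc i), s.sh, fun l' => if l' = l then none else s.lk l')
      | .exit => (P.next i (s.loc i), s.sh, s.lk)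
      | .nsync m => ((P.update i (s.loc i) m s.sh).1, (P.update i (s.loc i) m s.sh).2, s.lk)
    { loc := Function.update s.loc i r.1
      sh := r.2.1
      lk := r.2.2
      wait :=
        if (P.kind i r.1).isBarrier then
          (if s.wait ∪ {i} = Set.univ then (∅ : Set (Fin P.n)) else s.wait ∪ {i})
        else s.wait }

/-- Finite executions: `Exec s ts sf` means the statement sequence `ts` is
step-by-step enabled starting from `s` and leads to `sf`. -/
inductive Exec : GState P → List (GStmt P) → GState P → Prop
  | nil (s : GState P) : Exec s [] s
  | cons {s s' sf : GState P} {t : GStmt P} {l : List (GStmt P)} :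
      Enabled s t → execute s t = s' → Exec s' l sf → Exec s (t :: l) sf

/-- The program has no barrier local states. -/
def NoBarriers (P : Program) : Prop := ∀ i σ, P.kind i σ ≠ LKind.barrier

/-! ### Traces, events, happens-before, data races -/

/-- The thread ID of the event at position `k` of a trace (if any). -/
def tidAt (ts : List (GStmt P)) (k : ℕ) : Option (Fin P.n) := (ts[k]?).map (·.1)

/-- The statement at position `k` satisfies `p`. -/
def stmtIs (ts : List (GStmt P)) (k : ℕ) (p : GStmt P → Prop) : Prop :=
  ∃ t, ts[k]? = some t ∧ p t

/-- Intra-thread order on trace positions. -/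
def IntraThread (ts : List (GStmt P)) (j k : ℕ) : Prop :=
  j < k ∧ k < ts.length ∧ tidAt ts j = tidAt ts k

/-- Release-acquire relation on trace positions: a release of `l` is related to
the next subsequent acquire of `l`. -/
def RelAcq (ts : List (GStmt P)) (j k : ℕ) : Prop :=
  ∃ l : P.Lock, j < k ∧ stmtIs ts j (·.isReleaseOn l) ∧ stmtIs ts k (·.isAcquireOn l) ∧
    ∀ m, j < m → m < k → ¬ stmtIs ts m (·.isAcquireOn l)

/-- The barrier epoch of the event at position `k`: the number of barrier-exit
events of the same thread at positions `≤ k`. -/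
noncomputable def epoch (ts : List (GStmt P)) (k : ℕ) : ℕ :=
  Set.ncard {m : ℕ | m ≤ k ∧ tidAt ts m = tidAt ts k ∧ stmtIs ts m (·.isExit)}

/-- Barrier relation on trace positions: earlier epochs happen before later ones. -/
def BarrierRel (ts : List (GStmt P)) (j k : ℕ) : Prop :=
  j < ts.length ∧ k < ts.length ∧ epoch ts j < epoch ts k

/-- The happens-before relation on trace positions. -/
def HB (ts : List (GStmt P)) : ℕ → ℕ → Prop :=
  Relation.TransGen (fun j k => IntraThread ts j k ∨ RelAcq ts j k ∨ BarrierRel ts j k)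

/-- `C` is a conflict relation for `P`: symmetric, relating only nsync statements
from different threads, and non-conflicting nsync statements from different
threads commute whenever both are enabled. -/
structure IsConflictRel (P : Program) (C : GStmt P → GStmt P → Prop) : Prop where
  symm : ∀ t1 t2, C t1 t2 → C t2 t1
  nsync_left : ∀ t1 t2, C t1 t2 → t1.isNsync
  nsync_right : ∀ t1 t2, C t1 t2 → t2.isNsync
  diff : ∀ t1 t2, C t1 t2 → t1.1 ≠ t2.1
  commute : ∀ t1 t2, t1.isNsync → t2.isNsync → t1.1 ≠ t2.1 → ¬ C t1 t2 →
    ∀ s : GState P, Enabled s t1 → Enabled s t2 →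
      execute (execute s t1) t2 = execute (execute s t2) t1

/-- The events at positions `j` and `k` race: their statements conflict and the
positions are unordered by happens-before. -/
def Races (C : GStmt P → GStmt P → Prop) (ts : List (GStmt P)) (j k : ℕ) : Prop :=
  (∃ t1 t2, ts[j]? = some t1 ∧ ts[k]? = some t2 ∧ C t1 t2) ∧ ¬ HB ts j k ∧ ¬ HB ts k j

/-- The trace contains a data race. -/
def HasRace (C : GStmt P → GStmt P → Prop) (ts : List (GStmt P)) : Prop :=
  ∃ j k, Races C ts j k

/-- The event (statement with per-thread occurrence number) at position `k`. -/
def eventAt (ts : List (GStmt P)) (k : ℕ) : Option (GStmt P × ℕ) :=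
  (ts[k]?).map (fun t => (t, (ts.take (k+1)).countP (fun t' => decide (t'.1 = t.1))))

/-- The set of events of a trace. -/
def events (ts : List (GStmt P)) : Set (GStmt P × ℕ) :=
  {e | ∃ k, eventAt ts k = some e}

/-! ### The race-detecting state graph -/

/-- The edge relation of the local graph of thread `i`. -/
def isLocalStep (i : Fin P.n) (σ σ' : P.Local i) : Prop :=
  match P.kind i σ with
  | .nsync => ∃ m ζ, m ∈ P.stmts i σ ∧ (P.update i σ m ζ).1 = σ'
  | .term => False
  | _ => σ' = P.next i σ

/-- Choice of sets `R i` containing all acquire and release local states and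
meeting every cycle of the local graph of thread `i`. -/
structure RSets (P : Program) where
  R : ∀ i, Set (P.Local i)
  acq_mem : ∀ i σ l, P.kind i σ = LKind.acquire l → σ ∈ R i
  rel_mem : ∀ i σ l, P.kind i σ = LKind.release l → σ ∈ R i
  acyclic : ∀ i σ, σ ∉ R i →
    ¬ Relation.TransGen (fun a b => a ∉ R i ∧ b ∉ R i ∧ isLocalStep i a b) σ σ

/-- Thread `i` is normal at state `s`: its local state is not in `R i` and it
has an enabled statement. -/
def Normal (RS : RSets P) (s : GState P) (i : Fin P.n) : Prop :=
  s.loc i ∉ RS.R i ∧ ∃ st : Stmt P.Lock (P.NStmt i), Enabled s ⟨i, st⟩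

/-- A node of the race-detecting state graph: a state together with, for each
thread, the set of nsync statements recorded since its last synchronization. -/
structure RNode (P : Program) where
  st : GState P
  hist : ∀ i, Set (P.NStmt i)

/-- Edge relation of the race-detecting state graph. -/
def REdge (RS : RSets P) (u : RNode P) (t : GStmt P) (v : RNode P) : Prop :=
  Enabled u.st t ∧ v.st = execute u.st t ∧
  (∀ m, t.2 = Stmt.nsync m → v.hist t.1 = insert m (u.hist t.1)) ∧
  (¬ t.isNsync →
    ((t.isExitZero ∨ u.st.loc t.1 ∈ RS.R t.1) → v.hist t.1 = ∅) ∧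
    (¬ (t.isExitZero ∨ u.st.loc t.1 ∈ RS.R t.1) → v.hist t.1 = u.hist t.1)) ∧
  (∀ i, i ≠ t.1 →
    (t.isExitZero → v.hist i = ∅) ∧ (¬ t.isExitZero → v.hist i = u.hist i)) ∧
  ((∃ i, Normal RS u.st i) → Normal RS u.st t.1 ∧ ∀ j, Normal RS u.st j → t.1 ≤ j)

/-- Paths in the race-detecting state graph. -/
inductive RPath (RS : RSets P) : RNode P → List (GStmt P) → RNode P → Prop
  | nil (u : RNode P) : RPath RS u [] u
  | cons {u v w : RNode P} {t : GStmt P} {l : List (GStmt P)} :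
      REdge RS u t v → RPath RS v l w → RPath RS u (t :: l) w

/-- Reachability in the race-detecting state graph. -/
def RReach (RS : RSets P) (u v : RNode P) : Prop := ∃ l, RPath RS u l v

/-- Thread `i` detects a race at node `u`. -/
def ThreadDetects (C : GStmt P → GStmt P → Prop) (u : RNode P) (i : Fin P.n) : Prop :=
  ∃ j, j ≠ i ∧ ∃ m1 ∈ u.hist i, ∃ m2 ∈ u.hist j,
    C ⟨i, Stmt.nsync m1⟩ ⟨j, Stmt.nsync m2⟩

/-- The edge `(u,t,v)` detects a race: the moving thread arrives at an `R i`,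
barrier, or terminal local state and detects a race at the target node. -/
def EdgeDetects (RS : RSets P) (C : GStmt P → GStmt P → Prop)
    (u : RNode P) (t : GStmt P) (v : RNode P) : Prop :=
  REdge RS u t v ∧
  (v.st.loc t.1 ∈ RS.R t.1 ∨ (P.kind t.1 (v.st.loc t.1)).isBarrier = true ∨
    (P.kind t.1 (v.st.loc t.1)).isTerm = true) ∧
  ThreadDetects C v t.1

/-- The race-detecting state graph detects a race from `u0`. -/
def DetectsFrom (RS : RSets P) (C : GStmt P → GStmt P → Prop) (u0 : RNode P) : Prop :=
  ∃ u t v, RReach RS u0 u ∧ EdgeDetects RS C u t v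

/-- The initial node for state `s0`: all recorded sets empty. -/
def initNode (s0 : GState P) : RNode P := ⟨s0, fun _ => ∅⟩

/-! ### Abstract state graphs and density -/

/-- A state graph of `P`. -/
structure StateGraph (P : Program) where
  V : Type
  edge : V → GStmt P → V → Prop
  stateOf : V → GState P
  edge_enabled : ∀ {u t v}, edge u t v → Enabled (stateOf u) t
  edge_exec : ∀ {u t v}, edge u t v → stateOf v = execute (stateOf u) t
  edge_det : ∀ {u t v v'}, edge u t v → edge u t v' → v = v'

/-- The ample set of a node: the labels of its outgoing edges. -/
def StateGraph.ample (G : StateGraph P) (u : G.V) : Set (GStmt P) :=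
  {t | ∃ v, G.edge u t v}

/-- Paths in a state graph. -/
inductive GPath (G : StateGraph P) : G.V → List (GStmt P) → G.V → Prop
  | nil (u : G.V) : GPath G u [] u
  | cons {u v w : G.V} {t : GStmt P} {l : List (GStmt P)} :
      G.edge u t v → GPath G v l w → GPath G u (t :: l) w

/-- Density of a state graph (the four ample-set conditions). -/
def StateGraph.IsDense (G : StateGraph P) : Prop :=
  (∀ u, (∃ t, Enabled (G.stateOf u) t) → (G.ample u).Nonempty) ∧
  (∀ u t t', t ∈ G.ample u → Enabled (G.stateOf u) t' → t'.1 = t.1 → t' ∈ G.ample u) ∧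
  (∀ u, G.ample u ≠ {t | Enabled (G.stateOf u) t} → ∀ t ∈ G.ample u, t.isNsync) ∧
  (∀ u l, l ≠ [] → GPath G u l u →
    ∃ v l1 l2, l = l1 ++ l2 ∧ GPath G u l1 v ∧
      G.ample v = {t | Enabled (G.stateOf v) t})

/-! ### Paths as functions and block decompositions -/

/-- A path in the race-detecting state graph presented as a node function `f`
along a statement list `ts`. -/
def IsPathFn (RS : RSets P) (f : ℕ → RNode P) (ts : List (GStmt P)) : Prop :=
  ∀ k (h : k < ts.length), REdge RS (f k) (ts.get ⟨k, h⟩) (f (k+1))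

/-- The statement at position `m` continues the block started at position `b`:
it is from the same thread and that thread is normal at the node it executes from. -/
def SameBlockStep (RS : RSets P) (f : ℕ → RNode P) (ts : List (GStmt P)) (b m : ℕ) : Prop :=
  tidAt ts m = tidAt ts b ∧ ∃ t, ts[m]? = some t ∧ Normal RS (f m).st t.1

/-- `c 0 = 0 < c 1 < ⋯ < c N = |ts|` is the block decomposition of the path
`(f, ts)`: block `j` covers positions `[c j, c (j+1))`. -/
structure IsBlockDecomp (RS : RSets P) (f : ℕ → RNode P) (ts : List (GStmt P))
    (N : ℕ) (c : ℕ → ℕ) : Prop where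
  zero : c 0 = 0
  last : c N = ts.length
  mono : ∀ j, j < N → c j < c (j+1)
  inside : ∀ j, j < N → ∀ m, c j < m → m < c (j+1) → SameBlockStep RS f ts (c j) m
  boundary : ∀ j, j < N → c (j+1) < ts.length → ¬ SameBlockStep RS f ts (c j) (c (j+1))

/-- Block `j` is initial: its thread is normal at its starting node. -/
def BlockInitial (RS : RSets P) (f : ℕ → RNode P) (ts : List (GStmt P))
    (c : ℕ → ℕ) (j : ℕ) : Prop :=
  ∃ t, ts[c j]? = some t ∧ Normal RS (f (c j)).st t.1

/-- Block `j` is complete: its thread is not normal at its final node. -/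
def BlockComplete (RS : RSets P) (f : ℕ → RNode P) (ts : List (GStmt P))
    (c : ℕ → ℕ) (j : ℕ) : Prop :=
  ∀ t, ts[c j]? = some t → ¬ Normal RS (f (c (j+1))).st t.1

/-- The position permutation induced by transposing the adjacent segments
`[a,b)` and `[b,d)`. -/
def segSwap (a b d m : ℕ) : ℕ :=
  if m < a then m else if m < b then m + (d - b) else if m < d then m - (b - a) else m

/-- The position permutation induced by transposing positions `p` and `p+1`. -/
def posSwap (p m : ℕ) : ℕ :=
  if m = p then p + 1 else if m = p + 1 then p else m


theorem enabled_acq {s : GState P} {i : Fin P.n} {l : P.Lock} :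
    Enabled s ⟨i, .acquire l⟩ ↔ P.kind i (s.loc i) = .acquire l ∧ s.lk l = none := by
  cases h : P.kind i (s.loc i) <;> simp [Enabled, h]
  rintro rfl; rfl

theorem enabled_rel {s : GState P} {i : Fin P.n} {l : P.Lock} :
    Enabled s ⟨i, .release l⟩ ↔ P.kind i (s.loc i) = .release l ∧ s.lk l = some i := by
  cases h : P.kind i (s.loc i) <;> simp [Enabled, h]
  rintro rfl; rfl

theorem enabled_nsync {s : GState P} {i : Fin P.n} {m : P.NStmt i} :
    Enabled s ⟨i, .nsync m⟩ ↔ P.kind i (s.loc i) = .nsync ∧ m ∈ P.stmts i (s.loc i) := by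
  cases h : P.kind i (s.loc i) <;> simp [Enabled, h]

theorem enabled_exit (hnb : NoBarriers P) {s : GState P} {i : Fin P.n} :
    ¬ Enabled s ⟨i, .exit⟩ := by
  have := hnb i (s.loc i)
  cases h : P.kind i (s.loc i) <;> simp_all [Enabled]

theorem isBarrier_false (hnb : NoBarriers P) (i : Fin P.n) (σ : P.Local i) :
    (P.kind i σ).isBarrier = false := by
  have := hnb i σ
  cases h : P.kind i σ <;> simp_all [LKind.isBarrier]

open Classical in
theorem execute_acq (hnb : NoBarriers P) (s : GState P) (i : Fin P.n) (l : P.Lock) :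
    execute s ⟨i, .acquire l⟩ =
      ⟨Function.update s.loc i (P.next i (s.loc i)), s.sh,
        fun l' => if l' = l then some i else s.lk l', s.wait⟩ := by
  simp [execute, isBarrier_false hnb]

open Classical in
theorem execute_rel (hnb : NoBarriers P) (s : GState P) (i : Fin P.n) (l : P.Lock) :
    execute s ⟨i, .release l⟩ =
      ⟨Function.update s.loc i (P.next i (s.loc i)), s.sh,
        fun l' => if l' = l then none else s.lk l', s.wait⟩ := by
  simp [execute, isBarrier_false hnb]

theorem execute_nsync (hnb : NoBarriers P) (s : GState P) (i : Fin P.n) (m : P.NStmt i) :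
    execute s ⟨i, .nsync m⟩ =
      ⟨Function.update s.loc i (P.update i (s.loc i) m s.sh).1, (P.update i (s.loc i) m s.sh).2,
        s.lk, s.wait⟩ := by
  simp [execute, isBarrier_false hnb]

theorem execute_loc_ne (s : GState P) (t : GStmt P) {j : Fin P.n} (h : j ≠ t.1) :
    (execute s t).loc j = s.loc j := by
  obtain ⟨i, st⟩ := t
  cases st <;> simp_all [execute]

/-- nsync enabledness only depends on the local state. -/
theorem enabled_nsync_congr {s s' : GState P} {t : GStmt P} (ht : t.isNsync)
    (h : s.loc t.1 = s'.loc t.1) : Enabled s t ↔ Enabled s' t := by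
  obtain ⟨i, st⟩ := t
  obtain ⟨m, hm⟩ := ht
  simp only at h hm m
  subst hm
  rw [enabled_nsync, enabled_nsync, h]

theorem enabled_nsync_exec {s : GState P} {t a : GStmt P} (ht : t.isNsync)
    (h : t.1 ≠ a.1) : Enabled (execute s a) t ↔ Enabled s t :=
  enabled_nsync_congr ht (execute_loc_ne s a h)

theorem swap (hnb : NoBarriers P) {C : GStmt P → GStmt P → Prop} (hC : IsConflictRel P C)
    {s : GState P} {u a : GStmt P} (hne : u.1 ≠ a.1) (hu : Enabled s u)
    (ha : Enabled (execute s u) a)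
    (hra : ∀ l, a.2 = .acquire l → u.2 ≠ .release l) (hc : ¬ C u a) :
    Enabled s a ∧ Enabled (execute s a) u ∧
      execute (execute s a) u = execute (execute s u) a := by
  classical
  by_cases hn : u.isNsync ∧ a.isNsync
  · have h1 : Enabled s a := (enabled_nsync_exec hn.2 hne.symm).1 ha
    exact ⟨h1, (enabled_nsync_exec hn.1 hne).2 hu,
      (hC.commute _ _ hn.1 hn.2 hne hc s hu h1).symm⟩
  obtain ⟨i, st⟩ := u
  obtain ⟨j, st'⟩ := a
  simp only at hne hra
  have hne' := hne.symm
  cases st with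
  | exit => exact absurd hu (enabled_exit hnb)
  | acquire l =>
    cases st' with
    | exit => exact absurd ha (enabled_exit hnb)
    | acquire l' =>
      simp only [execute_acq hnb, enabled_acq, Function.update_of_ne hne,
        Function.update_of_ne hne'] at *
      have : l' ≠ l := by rintro rfl; simp at ha
      have h2 := this.symm
      simp only [if_neg this, if_neg h2] at *
      refine ⟨ha, hu, ?_⟩
      rw [Function.update_comm hne']
      congr 1
      funext x; split_ifs <;> simp_all
    | release l' =>
      simp only [execute_acq hnb, execute_rel hnb, enabled_acq, enabled_rel,
        Function.update_of_ne hne, Function.update_of_ne hne'] at *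
      have : l' ≠ l := by rintro rfl; simp [hne] at ha
      have h2 := this.symm
      simp only [if_neg this, if_neg h2] at *
      refine ⟨ha, hu, ?_⟩
      rw [Function.update_comm hne']
      congr 1
      funext x; split_ifs <;> simp_all
    | nsync m =>
      simp only [execute_acq hnb, execute_nsync hnb, enabled_acq, enabled_nsync,
        Function.update_of_ne hne, Function.update_of_ne hne'] at *
      refine ⟨ha, hu, ?_⟩
      rw [Function.update_comm hne']
  | release l =>
    cases st' with
    | exit => exact absurd ha (enabled_exit hnb)
    | acquire l' =>
      have : l' ≠ l := by rintro rfl; exact hra _ rfl rfl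
      clear hra
      simp only [execute_acq hnb, execute_rel hnb, enabled_acq, enabled_rel,
        Function.update_of_ne hne, Function.update_of_ne hne'] at *
      have h2 := this.symm
      simp only [if_neg this, if_neg h2] at *
      refine ⟨ha, hu, ?_⟩
      rw [Function.update_comm hne']
      congr 1
      funext x; split_ifs <;> simp_all
    | release l' =>
      simp only [execute_acq hnb, execute_rel hnb, enabled_acq, enabled_rel,
        Function.update_of_ne hne, Function.update_of_ne hne'] at *
      have : l' ≠ l := by rintro rfl; simp at ha
      have h2 := this.symm
      simp only [if_neg this, if_neg h2] at *
      refine ⟨ha, hu, ?_⟩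
      rw [Function.update_comm hne']
      congr 1
      funext x; split_ifs <;> simp_all
    | nsync m =>
      simp only [execute_rel hnb, execute_nsync hnb, enabled_rel, enabled_nsync,
        Function.update_of_ne hne, Function.update_of_ne hne'] at *
      refine ⟨ha, hu, ?_⟩
      rw [Function.update_comm hne']
  | nsync m =>
    cases st' with
    | exit => exact absurd ha (enabled_exit hnb)
    | acquire l' =>
      simp only [execute_acq hnb, execute_nsync hnb, enabled_acq, enabled_nsync,
        Function.update_of_ne hne, Function.update_of_ne hne'] at *
      refine ⟨ha, hu, ?_⟩
      rw [Function.update_comm hne']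
    | release l' =>
      simp only [execute_rel hnb, execute_nsync hnb, enabled_rel, enabled_nsync,
        Function.update_of_ne hne, Function.update_of_ne hne'] at *
      refine ⟨ha, hu, ?_⟩
      rw [Function.update_comm hne']
    | nsync m' => exact absurd ⟨⟨_, rfl⟩, ⟨_, rfl⟩⟩ hn

theorem Exec.append {s x y : GState P} {l1 l2 : List (GStmt P)} (h : Exec s l1 x)
    (h2 : Exec x l2 y) : Exec s (l1 ++ l2) y := by
  induction h with
  | nil => exact h2
  | cons a b _ ih => exact Exec.cons a b (ih h2)

theorem Exec.split {l1 : List (GStmt P)} : ∀ {s y : GState P} {l2 : List (GStmt P)},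
    Exec s (l1 ++ l2) y → ∃ x, Exec s l1 x ∧ Exec x l2 y := by
  induction l1 with
  | nil => intro s y l2 h; exact ⟨s, Exec.nil _, h⟩
  | cons t l ih =>
    intro s y l2 h
    cases h with
    | cons a b c =>
      obtain ⟨x, h1, h2⟩ := ih c
      exact ⟨x, Exec.cons a b h1, h2⟩

theorem Exec.loc_eq {s y : GState P} {l : List (GStmt P)} {k : Fin P.n} (h : Exec s l y)
    (hk : ∀ t ∈ l, t.1 ≠ k) : y.loc k = s.loc k := by
  induction h with
  | nil => rfl
  | cons a b _ ih =>
    rw [ih (fun t ht => hk t (List.mem_cons_of_mem _ ht)), ← b]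
    exact execute_loc_ne _ _ (hk _ List.mem_cons_self).symm

/-- A co-enabled conflict is reachable. -/
def CoR (C : GStmt P → GStmt P → Prop) (x : GState P) : Prop :=
  ∃ ts s t1 t2, Exec x ts s ∧ Enabled s t1 ∧ Enabled s t2 ∧ C t1 t2

theorem CoR.cons {C : GStmt P → GStmt P → Prop} {x : GState P} {t : GStmt P}
    (ht : Enabled x t) (h : CoR C (execute x t)) : CoR C x := by
  obtain ⟨ts, s, t1, t2, h1, h2⟩ := h
  exact ⟨t :: ts, s, t1, t2, Exec.cons ht rfl h1, h2⟩

theorem CoR.append {C : GStmt P → GStmt P → Prop} {x y : GState P} {l : List (GStmt P)}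
    (hl : Exec x l y) (h : CoR C y) : CoR C x := by
  obtain ⟨ts, s, t1, t2, h1, h2⟩ := h
  exact ⟨_, s, t1, t2, hl.append h1, h2⟩

theorem pullU (hnb : NoBarriers P) {C : GStmt P → GStmt P → Prop} (hC : IsConflictRel P C)
    {x y : GState P} {U : List (GStmt P)} {a : GStmt P} (h : Exec x U y) (ha : Enabled y a)
    (hne : ∀ u ∈ U, u.1 ≠ a.1)
    (hra : ∀ l, a.2 = .acquire l → ∀ u ∈ U, u.2 ≠ .release l) :
    CoR C x ∨ (Enabled x a ∧ Exec (execute x a) U (execute y a) ∧ ∀ u ∈ U, ¬ C u a) := by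
  induction h with
  | nil => exact Or.inr ⟨ha, Exec.nil _, by simp⟩
  | @cons s s' sf u U hu hs' _ ih =>
    subst hs'
    rcases ih ha (fun t ht => hne t (List.mem_cons_of_mem _ ht))
      (fun l hl t ht => hra l hl t (List.mem_cons_of_mem _ ht)) with h | ⟨h1, h2, h3⟩
    · exact Or.inl (h.cons hu)
    · have hua := hne u List.mem_cons_self
      by_cases hc : C u a
      · left
        exact ⟨[], s, u, a, Exec.nil _, hu,
          (enabled_nsync_exec (hC.nsync_right _ _ hc) hua.symm).1 h1, hc⟩
      · obtain ⟨e1, e2, e3⟩ := swap hnb hC hua hu h1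
          (fun l hl => hra l hl u List.mem_cons_self) hc
        refine Or.inr ⟨e1, Exec.cons e2 e3 h2, ?_⟩
        intro v hv
        rcases List.mem_cons.1 hv with rfl | hv
        · exact hc
        · exact h3 v hv

/-- Taint tracking. -/
def Taint (T : Fin P.n → Prop) (L : P.Lock → Prop) (t : GStmt P) : Prop :=
  T t.1 ∨ ∃ l, t.2 = .acquire l ∧ L l

inductive Hit (C : GStmt P → GStmt P → Prop) (t1 : GStmt P) :
    (Fin P.n → Prop) → (P.Lock → Prop) → List (GStmt P) → Prop
  | found {T L t A} : ¬ Taint T L t → C t1 t → Hit C t1 T L (t :: A)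
  | taint {T L t A} : Taint T L t →
      Hit C t1 (fun k => T k ∨ k = t.1)
        (fun l => (L l ∧ t.2 ≠ .acquire l) ∨ t.2 = .release l) A → Hit C t1 T L (t :: A)
  | untaint {T L t A} : ¬ Taint T L t → Hit C t1 T L A → Hit C t1 T L (t :: A)

theorem core (hnb : NoBarriers P) {C : GStmt P → GStmt P → Prop} (hC : IsConflictRel P C)
    {t1 : GStmt P} {T : Fin P.n → Prop} {L : P.Lock → Prop} {A : List (GStmt P)}
    (h : Hit C t1 T L A) : ∀ (x y z : GState P) (U : List (GStmt P)), Exec x U y → Exec y A z →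
      t1 ∈ U → (∀ u ∈ U, T u.1) →
      (∀ l, ∀ u ∈ U, u.2 = .release l → L l ∨ ∃ k, T k ∧ y.lk l = some k) → CoR C x := by
  classical
  induction h with
  | @found T L t A hT hc =>
    intro x y z U hU hA h1 hUT hL
    cases hA with
    | cons ha hs hA =>
    rcases pullU hnb hC hU ha (fun u hu e => hT (Or.inl (e ▸ hUT u hu))) (by
      intro l hl
      obtain ⟨m, hm⟩ := hC.nsync_right _ _ hc
      rw [hm] at hl; cases hl) with h | ⟨_, _, h⟩
    · exact h
    · exact absurd hc (h _ h1)
  | @taint T L t A hT _ ih =>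
    intro x y z U hU hA h1 hUT hL
    cases hA with
    | cons ha hs hA =>
    subst hs
    refine ih x _ z (U ++ [t]) (hU.append (Exec.cons ha rfl (Exec.nil _))) hA (by simp [h1]) ?_ ?_
    · intro u hu
      rcases List.mem_append.1 hu with hu | hu
      · exact Or.inl (hUT u hu)
      · simp at hu; subst hu; exact Or.inr rfl
    · intro l u hu hul
      by_cases hr : t.2 = .release l
      · exact Or.inl (Or.inr hr)
      replace hu : u ∈ U := by
        rcases List.mem_append.1 hu with hu | hu
        · exact hu
        · simp at hu; subst hu; exact absurd hul hr
      obtain ⟨i, st⟩ := t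
      by_cases hq : st = .acquire l
      · subst hq
        right
        refine ⟨i, Or.inr rfl, ?_⟩
        simp [execute_acq hnb]
      rcases hL l u hu hul with h | ⟨k, hk, h⟩
      · exact Or.inl (Or.inl ⟨h, hq⟩)
      · right
        refine ⟨k, Or.inl hk, ?_⟩
        cases st with
        | exit => exact absurd ha (enabled_exit hnb)
        | nsync m => simpa [execute_nsync hnb] using h
        | acquire l' =>
          have : l ≠ l' := by rintro rfl; exact hq rfl
          simpa [execute_acq hnb, this] using h
        | release l' =>
          have : l ≠ l' := by rintro rfl; exact hr rfl
          simpa [execute_rel hnb, this] using h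
  | @untaint T L t A hT _ ih =>
    intro x y z U hU hA h1 hUT hL
    cases hA with
    | cons ha hs hA =>
    subst hs
    have hrel : ∀ l, t.2 = .acquire l → ∀ u ∈ U, u.2 ≠ .release l := by
      intro l hl u hu hul
      rcases hL l u hu hul with h | ⟨k, hk, h⟩
      · exact hT (Or.inr ⟨l, hl, h⟩)
      · obtain ⟨i, st⟩ := t
        simp only at hl
        subst hl
        rw [(enabled_acq.1 ha).2] at h
        cases h
    rcases pullU hnb hC hU ha (fun u hu e => hT (Or.inl (e ▸ hUT u hu))) hrel with h | ⟨h2, h3, _⟩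
    · exact h
    · refine CoR.cons h2 (ih _ _ z U h3 hA h1 hUT ?_)
      intro l u hu hul
      rcases hL l u hu hul with h | ⟨k, hk, h⟩
      · exact Or.inl h
      · right
        refine ⟨k, hk, ?_⟩
        obtain ⟨i, st⟩ := t
        cases st with
        | exit => exact absurd ha (enabled_exit hnb)
        | nsync m => simpa [execute_nsync hnb] using h
        | acquire l' =>
          have : l ≠ l' := by rintro rfl; exact hrel _ rfl u hu hul
          simpa [execute_acq hnb, this] using h
        | release l' =>
          have : l ≠ l' := by
            rintro rfl
            rw [(enabled_rel.1 ha).2] at h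
            cases h
            exact hT (Or.inl hk)
          simpa [execute_rel hnb, this] using h

theorem hit_of_hb {C : GStmt P → GStmt P → Prop} {ts : List (GStmt P)} {p0 q : ℕ}
    {t1 t2 : GStmt P} (hq : ts[q]? = some t2) (hc : C t1 t2) (hn : ¬ HB ts p0 q) :
    ∀ (d p : ℕ) (T : Fin P.n → Prop) (L : P.Lock → Prop), p + d = q →
      (∀ k, T k → ∃ m, m < p ∧ tidAt ts m = some k ∧ (m = p0 ∨ HB ts p0 m)) →
      (∀ l, L l → ∃ m, m < p ∧ (m = p0 ∨ HB ts p0 m) ∧ stmtIs ts m (·.isReleaseOn l) ∧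
        ∀ m', m < m' → m' < p → ¬ stmtIs ts m' (·.isAcquireOn l)) →
      Hit C t1 T L (ts.drop p) := by
  intro d
  induction d with
  | zero =>
    intro p T L hp hT hL
    simp at hp
    subst hp
    obtain ⟨hlt, hget⟩ := List.getElem?_eq_some_iff.1 hq
    rw [List.drop_eq_getElem_cons hlt, hget]
    refine Hit.found ?_ hc
    rintro (h | ⟨l, h1, h2⟩)
    · obtain ⟨m, h1, h2, h3⟩ := hT _ h
      have e : HB ts m p := Relation.TransGen.single (Or.inl ⟨h1, hlt, by
        rw [h2]; simp [tidAt, hq]⟩)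
      rcases h3 with rfl | h3
      · exact hn e
      · exact hn (h3.trans e)
    · obtain ⟨m, h3, h4, h5, h6⟩ := hL _ h2
      have e : HB ts m p := Relation.TransGen.single (Or.inr (Or.inl ⟨l, h3, h5, ⟨t2, hq, h1⟩, h6⟩))
      rcases h4 with rfl | h4
      · exact hn e
      · exact hn (h4.trans e)
  | succ d ih =>
    intro p T L hp hT hL
    obtain ⟨hlt', hget'⟩ := List.getElem?_eq_some_iff.1 hq
    have hlt : p < ts.length := by omega
    obtain ⟨t, ht⟩ : ∃ t, ts[p] = t := ⟨_, rfl⟩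
    have hp? : ts[p]? = some t := by rw [List.getElem?_eq_getElem hlt, ht]
    rw [List.drop_eq_getElem_cons hlt, ht]
    by_cases hta : Taint T L t
    · have key : HB ts p0 p := by
        rcases hta with h | ⟨l, h1, h2⟩
        · obtain ⟨m, h1, h2, h3⟩ := hT _ h
          have e : HB ts m p := Relation.TransGen.single (Or.inl ⟨h1, hlt, by
            rw [h2]; simp [tidAt, hp?]⟩)
          rcases h3 with rfl | h3
          · exact e
          · exact h3.trans e
        · obtain ⟨m, h3, h4, h5, h6⟩ := hL _ h2
          have e : HB ts m p :=
            Relation.TransGen.single (Or.inr (Or.inl ⟨l, h3, h5, ⟨t, hp?, h1⟩, h6⟩))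
          rcases h4 with rfl | h4
          · exact e
          · exact h4.trans e
      refine Hit.taint hta (ih (p+1) _ _ (by omega) ?_ ?_)
      · rintro k (h | rfl)
        · obtain ⟨m, h1, h2⟩ := hT _ h
          exact ⟨m, by omega, h2⟩
        · exact ⟨p, by omega, by simp [tidAt, hp?], Or.inr key⟩
      · rintro l (⟨h, hna⟩ | h)
        · obtain ⟨m, h3, h4, h5, h6⟩ := hL _ h
          refine ⟨m, by omega, h4, h5, ?_⟩
          intro m' hm hm' hs
          rcases Nat.lt_or_ge m' p with hlt2 | hge
          · exact h6 m' hm hlt2 hs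
          · have : m' = p := by omega
            subst this
            obtain ⟨t', ht', ha⟩ := hs
            rw [hp?] at ht'
            cases ht'
            exact hna ha
        · exact ⟨p, by omega, Or.inr key, ⟨t, hp?, h⟩, by intro m' h1 h2; omega⟩
    · refine Hit.untaint hta (ih (p+1) _ _ (by omega) ?_ ?_)
      · intro k h
        obtain ⟨m, h1, h2⟩ := hT _ h
        exact ⟨m, by omega, h2⟩
      · intro l h
        obtain ⟨m, h3, h4, h5, h6⟩ := hL _ h
        refine ⟨m, by omega, h4, h5, ?_⟩
        intro m' hm hm' hs
        rcases Nat.lt_or_ge m' p with hlt2 | hge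
        · exact h6 m' hm hlt2 hs
        · have : m' = p := by omega
          subst this
          obtain ⟨t', ht', ha⟩ := hs
          rw [hp?] at ht'
          cases ht'
          exact hta (Or.inr ⟨l, ha, h⟩)

theorem coR_of_race (hnb : NoBarriers P) {C : GStmt P → GStmt P → Prop}
    (hC : IsConflictRel P C) {s sf : GState P} {ts : List (GStmt P)} (he : Exec s ts sf)
    (hr : HasRace C ts) : CoR C s := by
  have main : ∀ j k t1 t2, j < k → ts[j]? = some t1 → ts[k]? = some t2 → C t1 t2 →
      ¬ HB ts j k → CoR C s := by
    intro j k t1 t2 hjk h1 h2 hc hn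
    obtain ⟨hlt, hget⟩ := List.getElem?_eq_some_iff.1 h1
    have hit := hit_of_hb (p0 := j) h2 hc hn (k - (j+1)) (j+1) (fun i => i = t1.1) (fun _ => False)
      (by omega) (by
        rintro i rfl
        exact ⟨j, by omega, by simp [tidAt, h1], Or.inl rfl⟩) (by simp)
    have hsplit : ts = ts.take j ++ (t1 :: ts.drop (j+1)) := by
      rw [← hget, ← List.drop_eq_getElem_cons hlt, List.take_append_drop]
    rw [hsplit] at he
    obtain ⟨x, hx1, hx2⟩ := he.split
    refine CoR.append hx1 ?_
    cases hx2 with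
    | cons ha hs hA =>
      refine core hnb hC hit x _ _ [t1] (Exec.cons ha hs (Exec.nil _)) hA (by simp) (by simp) ?_
      intro l u hu hul
      simp at hu
      subst hu
      obtain ⟨m, hm⟩ := hC.nsync_left _ _ hc
      rw [hm] at hul; cases hul
  obtain ⟨j, k, ⟨t1, t2, h1, h2, hc⟩, hn1, hn2⟩ := hr
  rcases Nat.lt_trichotomy j k with h | rfl | h
  · exact main j k t1 t2 h h1 h2 hc hn1
  · rw [h1] at h2
    cases h2
    exact absurd rfl (hC.diff _ _ hc)
  · exact main k j t2 t1 h h2 h1 (hC.symm _ _ hc) hn2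

/-! soundness -/

theorem RPath.append {RS : RSets P} {u v w : RNode P} {l1 l2 : List (GStmt P)}
    (h : RPath RS u l1 v) (h2 : RPath RS v l2 w) : RPath RS u (l1 ++ l2) w := by
  induction h with
  | nil => exact h2
  | cons a _ ih => exact RPath.cons a (ih h2)

theorem RPath.exec {RS : RSets P} {u v : RNode P} {l : List (GStmt P)}
    (h : RPath RS u l v) : Exec u.st l v.st := by
  induction h with
  | nil => exact Exec.nil _
  | cons a _ ih => exact Exec.cons a.1 a.2.1.symm ih

theorem not_exitZero (hnb : NoBarriers P) {s : GState P} {t : GStmt P} (h : Enabled s t) :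
    ¬ t.isExit := by
  obtain ⟨i, st⟩ := t
  intro he
  simp only [GStmt.isExit] at he
  subst he
  exact enabled_exit hnb h

theorem Exec.no_exit (hnb : NoBarriers P) {s sf : GState P} {l : List (GStmt P)}
    (h : Exec s l sf) : ∀ t ∈ l, ¬ t.isExit := by
  induction h with
  | nil => simp
  | cons a _ _ ih =>
    intro t ht
    rcases List.mem_cons.1 ht with rfl | ht
    · exact not_exitZero hnb a
    · exact ih t ht

theorem sync_mem_R (hnb : NoBarriers P) (RS : RSets P) {s : GState P} {t : GStmt P}
    (h : Enabled s t) (hn : ¬ t.isNsync) : s.loc t.1 ∈ RS.R t.1 := by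
  obtain ⟨i, st⟩ := t
  cases st with
  | exit => exact absurd h (enabled_exit hnb)
  | nsync m => exact absurd ⟨m, rfl⟩ hn
  | acquire l => exact RS.acq_mem _ _ l (enabled_acq.1 h).1
  | release l => exact RS.rel_mem _ _ l (enabled_rel.1 h).1

def HInv (h : List (GStmt P)) (u : RNode P) : Prop :=
  ∀ i, ∀ m ∈ u.hist i, ∃ p, h[p]? = some (⟨i, .nsync m⟩ : GStmt P) ∧
    ∀ (q : ℕ) (t : GStmt P), p ≤ q → h[q]? = some t → t.1 = i → t.isNsync

theorem HInv.step (hnb : NoBarriers P) {RS : RSets P} {u v : RNode P} {t : GStmt P}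
    {h : List (GStmt P)} (hi : HInv h u) (he : REdge RS u t v) : HInv (h ++ [t]) v := by
  obtain ⟨h1, h2, h3, h4, h5, _⟩ := he
  have hx := not_exitZero hnb h1
  have old : ∀ i, ∀ m ∈ u.hist i, (t.1 = i → t.isNsync) → ∃ p, (h ++ [t])[p]? =
      some (⟨i, .nsync m⟩ : GStmt P) ∧
      ∀ (q : ℕ) (t' : GStmt P), p ≤ q → (h ++ [t])[q]? = some t' → t'.1 = i → t'.isNsync := by
    intro i m hm hti
    obtain ⟨p, hp, hq⟩ := hi i m hm
    obtain ⟨hlt, _⟩ := List.getElem?_eq_some_iff.1 hp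
    refine ⟨p, by rw [List.getElem?_append_left hlt]; exact hp, ?_⟩
    intro q t' hpq hq' hti'
    rcases Nat.lt_or_ge q h.length with hl | hl
    · rw [List.getElem?_append_left hl] at hq'
      exact hq q t' hpq hq' hti'
    · rw [List.getElem?_append_right hl] at hq'
      have : t' = t := by
        rw [List.getElem?_singleton] at hq'
        split_ifs at hq'
        · exact (Option.some.inj hq').symm
      subst this
      exact hti hti'
  intro i m hm
  by_cases hit : i = t.1
  · subst hit
    by_cases hn : t.isNsync
    · obtain ⟨m', hm'⟩ := hn
      rw [h3 m' hm'] at hm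
      rcases hm with rfl | hm
      · refine ⟨h.length, ?_, ?_⟩
        · rw [List.getElem?_append_right le_rfl]
          simp [← hm']
        · intro q t' hpq hq' _
          rw [List.getElem?_append_right hpq] at hq'
          rw [List.getElem?_singleton] at hq'
          split_ifs at hq'
          · cases hq'
            exact ⟨_, hm'⟩
      · exact old _ m hm (fun _ => ⟨m', hm'⟩)
    · rw [(h4 hn).1 (Or.inr (sync_mem_R hnb RS h1 hn))] at hm
      exact absurd hm (by simp)
  · rw [(h5 i hit).2 (fun e => hx e.1)] at hm
    exact old i m hm (fun e => absurd e.symm hit)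

theorem HInv.path (hnb : NoBarriers P) {RS : RSets P} {u v : RNode P}
    {l : List (GStmt P)} (hp : RPath RS u l v) : ∀ h, HInv h u → HInv (h ++ l) v := by
  induction hp with
  | nil => intro h hi; simpa using hi
  | cons a _ ih =>
    intro h hi
    have := ih _ (hi.step hnb a)
    simpa using this

theorem hb_same {ts : List (GStmt P)} (hx : ∀ t ∈ ts, ¬ t.isExit) {i : Fin P.n} {p : ℕ}
    (hp : tidAt ts p = some i)
    (hq : ∀ q t, p ≤ q → ts[q]? = some t → t.1 = i → t.isNsync) {q : ℕ} (h : HB ts p q) :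
    p ≤ q ∧ tidAt ts q = some i := by
  have step : ∀ a b, p ≤ a → tidAt ts a = some i →
      (IntraThread ts a b ∨ RelAcq ts a b ∨ BarrierRel ts a b) → p ≤ b ∧ tidAt ts b = some i := by
    intro a b hpa ha hab
    rcases hab with ⟨h1, _, h3⟩ | ⟨l, _, ⟨t, ht, hr⟩, _⟩ | ⟨_, _, h3⟩
    · exact ⟨by omega, by rw [← h3, ha]⟩
    · exfalso
      have : t.1 = i := by simpa [tidAt, ht] using ha
      obtain ⟨m, hm⟩ := hq a t hpa ht this
      simp only [GStmt.isReleaseOn] at hr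
      rw [hr] at hm
      cases hm
    · exfalso
      have : epoch ts b = 0 := by
        unfold epoch
        rw [show {m : ℕ | m ≤ b ∧ tidAt ts m = tidAt ts b ∧ stmtIs ts m (·.isExit)} = ∅ from ?_]
        · simp
        · ext m
          simp only [Set.mem_ofPred_eq, Set.mem_empty_iff_false, iff_false]
          rintro ⟨_, _, t, ht, hte⟩
          exact hx t (List.mem_of_getElem? ht) hte
      omega
  induction h with
  | single h => exact step _ _ le_rfl hp h
  | tail _ h ih => exact step _ _ ih.1 ih.2 h

theorem sound (hnb : NoBarriers P) {RS : RSets P} {C : GStmt P → GStmt P → Prop}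
    {s0 : GState P} (h : DetectsFrom RS C (initNode s0)) :
    ∃ ts sf, Exec s0 ts sf ∧ HasRace C ts := by
  obtain ⟨u, t, v, ⟨l, hl⟩, he, _, j, hji, m1, hm1, m2, hm2, hc⟩ := h
  have hp : RPath RS (initNode s0) (l ++ [t]) v := hl.append (RPath.cons he (RPath.nil _))
  have hex : Exec s0 (l ++ [t]) v.st := hp.exec
  refine ⟨_, _, hex, ?_⟩
  have hi := HInv.path hnb hp [] (by intro i m hm; exact absurd hm (by simp [initNode]))
  simp only [List.nil_append] at hi
  obtain ⟨p, hp1, hp2⟩ := hi _ m1 hm1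
  obtain ⟨q, hq1, hq2⟩ := hi _ m2 hm2
  have tp : tidAt (l ++ [t]) p = some t.1 := by simp [tidAt, hp1]
  have tq : tidAt (l ++ [t]) q = some j := by simp [tidAt, hq1]
  refine ⟨p, q, ⟨_, _, hp1, hq1, hc⟩, ?_, ?_⟩
  · intro hb
    have := (hb_same (hex.no_exit hnb) tp hp2 hb).2
    rw [tq] at this
    exact hji (Option.some.inj this)
  · intro hb
    have := (hb_same (hex.no_exit hnb) tq hq2 hb).2
    rw [tp] at this
    exact hji (Option.some.inj this).symm

theorem exists_edge (hnb : NoBarriers P) (RS : RSets P) {u : RNode P} {t : GStmt P}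
    (ht : Enabled u.st t)
    (ha : (∃ i, Normal RS u.st i) → Normal RS u.st t.1 ∧ ∀ j, Normal RS u.st j → t.1 ≤ j) :
    ∃ v, REdge RS u t v := by
  classical
  have hx := not_exitZero hnb ht
  obtain ⟨i, st⟩ := t
  by_cases hn : GStmt.isNsync ⟨i, st⟩
  · obtain ⟨m, hm⟩ := hn
    simp only at hm m
    subst hm
    refine ⟨⟨execute u.st ⟨i, .nsync m⟩, Function.update u.hist i (insert m (u.hist i))⟩,
      ht, rfl, ?_, ?_, ?_, ha⟩
    · intro m' hm'
      simp only at hm' m'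
      cases hm'
      simp
    · intro h; exact absurd ⟨m, rfl⟩ h
    · intro j hj
      simp only [ne_eq] at hj
      exact ⟨fun e => absurd e.1 hx, fun _ => by simp [Function.update_of_ne hj]⟩
  · refine ⟨⟨execute u.st ⟨i, st⟩, Function.update u.hist i ∅⟩,
      ht, rfl, ?_, ?_, ?_, ha⟩
    · intro m' hm'
      exact absurd ⟨m', hm'⟩ hn
    · intro _
      exact ⟨fun _ => by simp, fun e => absurd (Or.inr (sync_mem_R hnb RS ht hn)) e⟩
    · intro j hj
      simp only [ne_eq] at hj
      exact ⟨fun e => absurd e.1 hx, fun _ => by simp [Function.update_of_ne hj]⟩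

theorem REdge.hist_ne (hnb : NoBarriers P) {RS : RSets P} {u v : RNode P} {t : GStmt P}
    (h : REdge RS u t v) {i : Fin P.n} (hi : i ≠ t.1) : v.hist i = u.hist i :=
  (h.2.2.2.2.1 i hi).2 (fun e => not_exitZero hnb h.1 e.1)

theorem REdge.hist_sub (hnb : NoBarriers P) {RS : RSets P} {u v : RNode P} {t : GStmt P}
    (h : REdge RS u t v) (ht : t.isNsync) (i : Fin P.n) : u.hist i ⊆ v.hist i := by
  by_cases hi : i = t.1
  · subst hi
    obtain ⟨m, hm⟩ := ht
    rw [h.2.2.1 m hm]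
    exact Set.subset_insert _ _
  · rw [h.hist_ne hnb hi]

theorem REdge.hist_mem {RS : RSets P} {u v : RNode P} {i : Fin P.n} {m : P.NStmt i}
    (h : REdge RS u ⟨i, .nsync m⟩ v) : m ∈ v.hist i := by
  have := h.2.2.1 m rfl
  simp only at this
  rw [this]
  exact Set.mem_insert _ _

theorem normal_nsync (hnb : NoBarriers P) {RS : RSets P} {s : GState P} {t : GStmt P}
    (h : Enabled s t) (hR : s.loc t.1 ∉ RS.R t.1) : t.isNsync := by
  by_contra hn
  exact hR (sync_mem_R hnb RS h hn)

theorem normal_of_not (hnb : NoBarriers P) {RS : RSets P} {s : GState P} {i : Fin P.n}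
    (hR : s.loc i ∉ RS.R i) (ht : ¬ (P.kind i (s.loc i)).isTerm = true) : Normal RS s i := by
  refine ⟨hR, ?_⟩
  cases h : P.kind i (s.loc i) with
  | acquire l => exact absurd (RS.acq_mem _ _ _ h) hR
  | release l => exact absurd (RS.rel_mem _ _ _ h) hR
  | barrier => exact absurd h (hnb _ _)
  | term => rw [h] at ht; exact absurd rfl ht
  | nsync =>
    obtain ⟨m, hm⟩ := P.stmtsNonempty _ _ h
    exact ⟨.nsync m, enabled_nsync.2 ⟨h, hm⟩⟩

theorem min_normal {RS : RSets P} {s : GState P} (h : ∃ i, Normal RS s i) :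
    ∃ k, Normal RS s k ∧ ∀ j, Normal RS s j → k ≤ j := by
  classical
  obtain ⟨k, hk, hm⟩ := WellFounded.has_min (wellFounded_lt (α := Fin P.n)) {i | Normal RS s i} h
  exact ⟨k, hk, fun j hj => not_lt.1 (hm j hj)⟩

theorem DetectsFrom.step {RS : RSets P} {C : GStmt P → GStmt P → Prop} {u v : RNode P}
    {t : GStmt P} (he : REdge RS u t v) (h : DetectsFrom RS C v) : DetectsFrom RS C u := by
  obtain ⟨a, b, c, ⟨l, hl⟩, h2⟩ := h
  exact ⟨a, b, c, ⟨t :: l, RPath.cons he hl⟩, h2⟩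

theorem RReach.step {RS : RSets P} {u0 u v : RNode P} {t : GStmt P} (h : RReach RS u0 u)
    (he : REdge RS u t v) : RReach RS u0 v := by
  obtain ⟨l, hl⟩ := h
  exact ⟨_, hl.append (RPath.cons he (RPath.nil _))⟩

/-- Normal edges. -/
def NE (RS : RSets P) (u v : RNode P) : Prop := ∃ t, REdge RS u t v ∧ Normal RS u.st t.1

theorem NE.loc (hnb : NoBarriers P) {RS : RSets P} {u v : RNode P} {t : GStmt P}
    (he : REdge RS u t v) (hn : Normal RS u.st t.1) :
    isLocalStep t.1 (u.st.loc t.1) (v.st.loc t.1) := by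
  have hns := normal_nsync hnb he.1 hn.1
  have h1 := he.1
  have h2 := he.2.1
  obtain ⟨i, st⟩ := t
  obtain ⟨m, hm⟩ := hns
  simp only at hm m
  subst hm
  obtain ⟨hk, hm⟩ := enabled_nsync.1 h1
  rw [h2, execute_nsync hnb]
  simp only [isLocalStep, hk]
  exact ⟨m, u.st.sh, hm, by simp⟩

theorem NE.trans_loc (hnb : NoBarriers P) {RS : RSets P} {u v : RNode P} {k : Fin P.n}
    (h : Relation.ReflTransGen (NE RS) u v) (hv : v.st.loc k ∉ RS.R k) :
    u.st.loc k ∉ RS.R k ∧ (Relation.ReflTransGen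
      (fun a b => a ∉ RS.R k ∧ b ∉ RS.R k ∧ isLocalStep k a b) (u.st.loc k) (v.st.loc k)) := by
  induction h using Relation.ReflTransGen.head_induction_on with
  | refl => exact ⟨hv, Relation.ReflTransGen.refl⟩
  | @head a c h _ ih =>
    obtain ⟨t, he, hn⟩ := h
    by_cases hk : k = t.1
    · subst hk
      exact ⟨hn.1, Relation.ReflTransGen.head ⟨hn.1, ih.1, NE.loc hnb he hn⟩ ih.2⟩
    · have this := execute_loc_ne a.st t hk
      rw [← he.2.1] at this
      rw [← this]
      exact ih

theorem NE.irrefl (hnb : NoBarriers P) {RS : RSets P} {u : RNode P}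
    (h : Relation.TransGen (NE RS) u u) : False := by
  obtain ⟨w, ⟨t, he, hn⟩, hw⟩ := Relation.TransGen.head'_iff.1 h
  have := NE.trans_loc hnb hw hn.1
  exact RS.acyclic _ _ hn.1 (Relation.TransGen.head' ⟨hn.1, this.1, NE.loc hnb he hn⟩ this.2)

/-- Induction along normal edges from a reachable node. -/
theorem NE.ind (hnb : NoBarriers P) {RS : RSets P} {u0 : RNode P}
    (hfin : {v | RReach RS u0 v}.Finite) {Q : RNode P → Prop}
    (step : ∀ u, RReach RS u0 u → (∀ v, NE RS u v → Q v) → Q u) :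
    ∀ u, RReach RS u0 u → Q u := by
  have : Finite {v // RReach RS u0 v} := hfin.to_subtype
  let r : {v // RReach RS u0 v} → {v // RReach RS u0 v} → Prop :=
    fun a b => Relation.TransGen (NE RS) b.1 a.1
  have : IsTrans _ r := ⟨fun a b c h1 h2 => h2.trans h1⟩
  have : Std.Irrefl r := ⟨fun a h => NE.irrefl hnb h⟩
  have wf : WellFounded r := Finite.wellFounded_of_trans_of_irrefl r
  intro u hu
  have := wf.induction (C := fun a => Q a.1) ⟨u, hu⟩ (by
    rintro ⟨x, hx⟩ ih
    refine step x hx ?_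
    rintro v ⟨t, he, hn⟩
    exact ih ⟨v, hx.step he⟩ (Relation.TransGen.single ⟨t, he, hn⟩))
  exact this

/-- Pull a normal statement to the front. -/
theorem pull (hnb : NoBarriers P) {C : GStmt P → GStmt P → Prop} (hC : IsConflictRel P C)
    {x y : GState P} {ts : List (GStmt P)} {t : GStmt P} (ht : t.isNsync) (h : Exec x ts y)
    (hE : Enabled y t) (hne : ∀ u ∈ ts, u.1 ≠ t.1) :
    Enabled x t ∧ (Exec (execute x t) ts (execute y t) ∨
      ∃ A s' a, A.length < ts.length ∧ (∀ u ∈ A, u.1 ≠ t.1) ∧ Exec (execute x t) A s' ∧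
        Enabled s' a ∧ C t a) := by
  induction h with
  | nil => exact ⟨hE, Or.inl (Exec.nil _)⟩
  | @cons s s' sf a ts ha hs _ ih =>
    subst hs
    obtain ⟨h1, h2⟩ := ih hE (fun t ht => hne t (List.mem_cons_of_mem _ ht))
    have hat := hne a List.mem_cons_self
    have h1' : Enabled s t := (enabled_nsync_exec ht hat.symm).1 h1
    refine ⟨h1', ?_⟩
    by_cases hc : C t a
    · right
      refine ⟨[], execute s t, a, by simp, by simp, Exec.nil _, ?_, hc⟩
      exact (enabled_nsync_exec (hC.nsync_right _ _ hc) hat).2 ha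
    · obtain ⟨_, e2, e3⟩ := swap hnb hC hat ha h1 (by
        intro l hl
        obtain ⟨m, hm⟩ := ht
        rw [hm] at hl; cases hl) (fun e => hc (hC.symm _ _ e))
      rcases h2 with h2 | ⟨A, s', b, q1, q2, q3, q4⟩
      · exact Or.inl (Exec.cons e2 e3 h2)
      · right
        refine ⟨a :: A, s', b, by simpa using q1, ?_, Exec.cons e2 e3 q3, q4⟩
        intro u hu
        rcases List.mem_cons.1 hu with rfl | hu
        · exact hat
        · exact q2 u hu

def Aa (RS : RSets P) (C : GStmt P → GStmt P → Prop) (u : RNode P) : Prop :=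
  ∃ j, Normal RS u.st j ∧ ThreadDetects C u j

def Bb (C : GStmt P → GStmt P → Prop) (u : RNode P) (N : ℕ) : Prop :=
  ∃ i m ts s t2, ts.length ≤ N ∧ m ∈ u.hist i ∧ (∀ t ∈ ts, t.1 ≠ i) ∧ Exec u.st ts s ∧
    Enabled s t2 ∧ C ⟨i, .nsync m⟩ t2

def Cc (C : GStmt P → GStmt P → Prop) (u : RNode P) (N : ℕ) : Prop :=
  ∃ ts s t1 t2, ts.length ≤ N ∧ Exec u.st ts s ∧ Enabled s t1 ∧ Enabled s t2 ∧ C t1 t2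

section G
variable {RS : RSets P} {C : GStmt P → GStmt P → Prop} {u0 : RNode P}

theorem ThreadDetects.mono {u v : RNode P} (h : ∀ i, u.hist i ⊆ v.hist i) {i : Fin P.n}
    (hd : ThreadDetects C u i) : ThreadDetects C v i := by
  obtain ⟨j, hj, m1, h1, m2, h2, hc⟩ := hd
  exact ⟨j, hj, m1, h _ h1, m2, h _ h2, hc⟩

theorem good_A (hnb : NoBarriers P) (hfin : {v | RReach RS u0 v}.Finite) :
    ∀ u, RReach RS u0 u → Aa RS C u → DetectsFrom RS C u := by
  refine NE.ind hnb hfin ?_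
  rintro u hu ih ⟨j, hj, hd⟩
  obtain ⟨k, hk, hmin⟩ := min_normal ⟨j, hj⟩
  obtain ⟨hkR, st, hst⟩ := hk
  have hns : GStmt.isNsync ⟨k, st⟩ := normal_nsync hnb hst hkR
  obtain ⟨v, he⟩ := exists_edge hnb RS hst (fun _ => ⟨⟨hkR, st, hst⟩, hmin⟩)
  have hd' := hd.mono (he.hist_sub hnb hns)
  by_cases hn : Normal RS v.st j
  · exact (ih v ⟨_, he, ⟨hkR, st, hst⟩⟩ ⟨j, hn, hd'⟩).step he
  · have hjk : j = k := by
      by_contra hjk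
      apply hn
      have hl : v.st.loc j = u.st.loc j := by
        rw [he.2.1]; exact execute_loc_ne _ _ hjk
      obtain ⟨hjR, st', hst'⟩ := hj
      refine ⟨by rw [hl]; exact hjR, st', ?_⟩
      exact (enabled_nsync_congr (t := ⟨j, st'⟩) (normal_nsync hnb hst' hjR) hl).2 hst'
    subst hjk
    refine ⟨u, _, v, ⟨[], RPath.nil _⟩, he, ?_, hd'⟩
    by_contra hcon
    push Not at hcon
    exact hn (normal_of_not hnb hcon.1 hcon.2.2)

theorem fin_edge (hnb : NoBarriers P) (hfin : {v | RReach RS u0 v}.Finite) {u v : RNode P}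
    {t : GStmt P} (hu : RReach RS u0 u) (he : REdge RS u t v) (hd : ThreadDetects C v t.1) :
    DetectsFrom RS C u := by
  by_cases hcon : v.st.loc t.1 ∈ RS.R t.1 ∨ (P.kind t.1 (v.st.loc t.1)).isBarrier = true ∨
    (P.kind t.1 (v.st.loc t.1)).isTerm = true
  · exact ⟨u, _, v, ⟨[], RPath.nil _⟩, he, hcon, hd⟩
  · push Not at hcon
    exact (good_A hnb hfin v (hu.step he) ⟨t.1, normal_of_not hnb hcon.1 hcon.2.2, hd⟩).step he

/-- First occurrence of a thread in a list. -/
theorem first_occ (k : Fin P.n) (ts : List (GStmt P)) :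
    (∀ t ∈ ts, t.1 ≠ k) ∨ ∃ A t B, ts = A ++ t :: B ∧ t.1 = k ∧ ∀ a ∈ A, a.1 ≠ k := by
  induction ts with
  | nil => left; simp
  | cons a ts ih =>
    by_cases ha : a.1 = k
    · exact Or.inr ⟨[], a, ts, rfl, ha, by simp⟩
    rcases ih with h | ⟨A, t, B, rfl, h2, h3⟩
    · left
      intro t ht
      rcases List.mem_cons.1 ht with rfl | ht
      · exact ha
      · exact h t ht
    · refine Or.inr ⟨a :: A, t, B, rfl, h2, ?_⟩
      intro t ht
      rcases List.mem_cons.1 ht with rfl | ht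
      · exact ha
      · exact h3 t ht

/-- One normal step: given the minimal normal thread `k`, a run `ts` and (in case `k` does not
occur in `ts`) a preferred statement. -/
theorem normal_step (hnb : NoBarriers P) (hC : IsConflictRel P C) {u : RNode P} {k : Fin P.n}
    (hk : Normal RS u.st k) (hmin : ∀ j, Normal RS u.st j → k ≤ j) {ts : List (GStmt P)}
    {s : GState P} (h : Exec u.st ts s) (pref : GStmt P) (hpref : pref.isNsync)
    (hps : Enabled s pref) :
    ∃ t v, t.1 = k ∧ t.isNsync ∧ REdge RS u t v ∧
      ((∃ A, A.length < ts.length ∧ Exec v.st A s ∧ (∀ a ∈ A, a ∈ ts) ∧ ∃ a ∈ ts, a.1 = k) ∨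
       (∃ N, N < ts.length ∧ Bb C v N) ∨
       ((∀ a ∈ ts, a.1 ≠ k) ∧ Exec v.st ts (execute s t) ∧ (pref.1 = k → t = pref))) := by
  have bb : ∀ {t : GStmt P} {v : RNode P} {A : List (GStmt P)} {s' : GState P} {a : GStmt P},
      REdge RS u t v → t.isNsync → (∀ u ∈ A, u.1 ≠ t.1) → Exec (execute u.st t) A s' →
      Enabled s' a → C t a → Bb C v A.length := by
    intro t v A s' a he ht hA hx ha hc
    obtain ⟨i, st⟩ := t
    obtain ⟨m, hm⟩ := ht
    simp only at hm m
    subst hm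
    exact ⟨i, m, A, s', a, le_rfl, he.hist_mem, hA, by rw [he.2.1]; exact hx, ha, hc⟩
  rcases first_occ k ts with hno | ⟨A, t, B, rfl, htk, hA⟩
  · obtain ⟨t, htk, htn, hts, htp⟩ : ∃ t : GStmt P, t.1 = k ∧ t.isNsync ∧ Enabled s t ∧
        (pref.1 = k → t = pref) := by
      by_cases hp : pref.1 = k
      · exact ⟨pref, hp, hpref, hps, fun _ => rfl⟩
      · obtain ⟨hkR, st, hst⟩ := hk
        have hns : GStmt.isNsync ⟨k, st⟩ := normal_nsync hnb hst hkR
        exact ⟨⟨k, st⟩, rfl, hns, (enabled_nsync_congr hns (h.loc_eq hno)).2 hst,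
          fun e => absurd e hp⟩
    subst htk
    obtain ⟨h1, h2⟩ := pull hnb hC htn h hts hno
    obtain ⟨v, he⟩ := exists_edge hnb RS h1 (fun _ => ⟨hk, hmin⟩)
    refine ⟨t, v, rfl, htn, he, Or.inr ?_⟩
    rcases h2 with h2 | ⟨A, s', a, q1, q2, q3, q4, q5⟩
    · exact Or.inr ⟨hno, by rw [he.2.1]; exact h2, htp⟩
    · exact Or.inl ⟨_, q1, bb he htn q2 q3 q4 q5⟩
  · obtain ⟨x, hx1, hx2⟩ := h.split
    cases hx2 with
    | cons ha hs hB =>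
    subst hs
    subst htk
    have htR : x.loc t.1 ∉ RS.R t.1 := by rw [hx1.loc_eq hA]; exact hk.1
    have htn : t.isNsync := normal_nsync hnb ha htR
    obtain ⟨h1, h2⟩ := pull hnb hC htn hx1 ha hA
    obtain ⟨v, he⟩ := exists_edge hnb RS h1 (fun _ => ⟨hk, hmin⟩)
    refine ⟨t, v, rfl, htn, he, ?_⟩
    rcases h2 with h2 | ⟨A', s', a, q1, q2, q3, q4, q5⟩
    · refine Or.inl ⟨A ++ B, by simp, ?_, ?_, ⟨t, by simp, rfl⟩⟩
      · rw [he.2.1]; exact h2.append hB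
      · intro a ha; simp at ha ⊢; tauto
    · exact Or.inr (Or.inl ⟨_, by simp; omega, bb he htn q2 q3 q4 q5⟩)

theorem good_B (hnb : NoBarriers P) (hC : IsConflictRel P C)
    (hfin : {v | RReach RS u0 v}.Finite) (N : ℕ) :
    ∀ u, RReach RS u0 u → Bb C u N → DetectsFrom RS C u := by
  induction N using Nat.strong_induction_on with
  | _ N IH =>
  refine NE.ind hnb hfin ?_
  rintro u hu ih ⟨i, m, ts, s, t2, hlen, hm, hno, hex, hen, hc⟩
  have hn2 := hC.nsync_right _ _ hc
  have hdiff : i ≠ t2.1 := hC.diff _ _ hc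
  have fin2 : ∀ v, REdge RS u t2 v → DetectsFrom RS C u := by
    intro v he
    refine fin_edge hnb hfin hu he ?_
    have hmv := he.hist_sub hnb hn2 i hm
    obtain ⟨j, st⟩ := t2
    obtain ⟨m2, hm2⟩ := hn2
    simp only at hm2 m2
    subst hm2
    exact ⟨i, hdiff, m2, he.hist_mem, m, hmv, hC.symm _ _ hc⟩
  by_cases hnorm : ∃ k, Normal RS u.st k
  · obtain ⟨k, hk, hmin⟩ := min_normal hnorm
    obtain ⟨t, v, htk, htn, he, hcase⟩ := normal_step (C := C) hnb hC hk hmin hex t2 hn2 hen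
    have hmv := he.hist_sub hnb htn i hm
    rcases hcase with ⟨A, h1, h2, h3, _⟩ | ⟨M, h1, h2⟩ | ⟨h1, h2, h3⟩
    · exact (IH A.length (by omega) v (hu.step he) ⟨i, m, A, s, t2, le_rfl, hmv,
        fun t ht => hno t (h3 t ht), h2, hen, hc⟩).step he
    · exact (IH M (by omega) v (hu.step he) h2).step he
    · by_cases h2k : t2.1 = k
      · have := h3 h2k
        subst this
        exact fin2 v he
      · refine (ih v ⟨t, he, htk ▸ hk⟩ ⟨i, m, ts, _, t2, hlen, hmv, hno, h2, ?_, hc⟩).step he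
        exact (enabled_nsync_exec hn2 (htk ▸ h2k)).2 hen
  · cases hex with
    | nil =>
      obtain ⟨v, he⟩ := exists_edge hnb RS hen (fun e => absurd e hnorm)
      exact fin2 v he
    | @cons _ _ _ a l ha hs hl =>
      subst hs
      obtain ⟨v, he⟩ := exists_edge hnb RS ha (fun e => absurd e hnorm)
      simp at hlen
      refine (IH l.length (by omega) v (hu.step he) ⟨i, m, l, s, t2, le_rfl, ?_, ?_, ?_, hen, hc⟩).step he
      · rw [he.hist_ne hnb (hno a List.mem_cons_self).symm]; exact hm
      · exact fun t ht => hno t (List.mem_cons_of_mem _ ht)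
      · rw [he.2.1]; exact hl

theorem good_C (hnb : NoBarriers P) (hC : IsConflictRel P C)
    (hfin : {v | RReach RS u0 v}.Finite) (N : ℕ) :
    ∀ u, RReach RS u0 u → Cc C u N → DetectsFrom RS C u := by
  induction N using Nat.strong_induction_on with
  | _ N IH =>
  refine NE.ind hnb hfin ?_
  rintro u hu ih ⟨ts, s, t1, t2, hlen, hex, hen1, hen2, hc⟩
  by_cases hnorm : ∃ k, Normal RS u.st k
  · obtain ⟨k, hk, hmin⟩ := min_normal hnorm
    obtain ⟨t1, t2, hen1, hen2, hc, h2k⟩ : ∃ t1 t2, Enabled s t1 ∧ Enabled s t2 ∧ C t1 t2 ∧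
        t2.1 ≠ k := by
      by_cases h : t2.1 = k
      · exact ⟨t2, t1, hen2, hen1, hC.symm _ _ hc, fun e => hC.diff _ _ hc (e.trans h.symm)⟩
      · exact ⟨t1, t2, hen1, hen2, hc, h⟩
    have hn1 := hC.nsync_left _ _ hc
    have hn2 := hC.nsync_right _ _ hc
    obtain ⟨t, v, htk, htn, he, hcase⟩ := normal_step (C := C) hnb hC hk hmin hex t1 hn1 hen1
    rcases hcase with ⟨A, h1, h2, _, _⟩ | ⟨M, h1, h2⟩ | ⟨h1, h2, h3⟩
    · exact (IH A.length (by omega) v (hu.step he) ⟨A, s, t1, t2, le_rfl, h2, hen1, hen2, hc⟩).step he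
    · exact (good_B hnb hC hfin M v (hu.step he) h2).step he
    · have hen2' : Enabled (execute s t) t2 := (enabled_nsync_exec hn2 (htk ▸ h2k)).2 hen2
      by_cases h1k : t1.1 = k
      · have := h3 h1k
        subst this
        refine (good_B hnb hC hfin ts.length v (hu.step he) ?_).step he
        obtain ⟨j, st⟩ := t
        obtain ⟨m, hm⟩ := hn1
        simp only at hm m htk
        subst hm
        subst htk
        exact ⟨j, m, ts, _, t2, le_rfl, he.hist_mem, h1, h2, hen2', hc⟩
      · refine (ih v ⟨t, he, htk ▸ hk⟩ ⟨ts, _, t1, t2, hlen, h2, ?_, hen2', hc⟩).step he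
        exact (enabled_nsync_exec hn1 (htk ▸ h1k)).2 hen1
  · cases hex with
    | nil =>
      obtain ⟨v, he⟩ := exists_edge hnb RS hen1 (fun e => absurd e hnorm)
      refine (good_B hnb hC hfin 0 v (hu.step he) ?_).step he
      have hdiff := hC.diff _ _ hc
      have hn1 := hC.nsync_left _ _ hc
      have hen2' : Enabled v.st t2 := by
        rw [he.2.1]; exact (enabled_nsync_exec (hC.nsync_right _ _ hc) hdiff.symm).2 hen2
      obtain ⟨j, st⟩ := t1
      obtain ⟨m, hm⟩ := hn1
      simp only at hm m
      subst hm
      exact ⟨j, m, [], _, t2, le_rfl, he.hist_mem, by simp, Exec.nil _, hen2', hc⟩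
    | @cons _ _ _ a l ha hs hl =>
      subst hs
      obtain ⟨v, he⟩ := exists_edge hnb RS ha (fun e => absurd e hnorm)
      simp at hlen
      refine (IH l.length (by omega) v (hu.step he) ⟨l, s, t1, t2, le_rfl, ?_, hen1, hen2, hc⟩).step he
      rw [he.2.1]; exact hl

end G

/-- Race detection theorem (barrier-free case), part 1: the program has a racy
execution from `s0` iff the race-detecting state graph detects a race from the
initial node for `s0`. -/
theorem stmt16 (P : Program) (hnb : NoBarriers P) (RS : RSets P)
    (C : GStmt P → GStmt P → Prop) (hC : IsConflictRel P C)
    (s0 : GState P)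
    (hfin : {v | RReach RS (initNode s0) v}.Finite) :
    (∃ ts sf, Exec s0 ts sf ∧ HasRace C ts) ↔ DetectsFrom RS C (initNode s0) := by
  constructor
  · rintro ⟨ts, sf, he, hr⟩
    obtain ⟨l, s, t1, t2, h1, h2, h3, h4⟩ := coR_of_race hnb hC he hr
    exact good_C hnb hC hfin l.length _ ⟨[], RPath.nil _⟩ ⟨l, s, t1, t2, le_rfl, h1, h2, h3, h4⟩
  · exact sound hnb

end MC
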